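/- Let a ≥ 3 be an integer with a ≢ 2 (mod 4) and A = {1, 2, a}. Then the Diophantine equation P_A(m) = P₄(n) has infinitely many solutions in positive integers, i.e., the set {(m, n) ∈ ℕ₊ × ℕ₊ : P_A(m) = P₄(n)} is infinite. -/

import Mathlib

/-- `partCount A n` is the number of partitions of `n` into parts from `A`. -/
def partCount (A : Finset ℕ) (n : ℕ) : ℕ :=
  ((Finset.univ : Finset (Nat.Partition n)).filter (fun p => ∀ i ∈ p.parts, i ∈ A)).card

/-- Splitting the partitions of `n + a` according to whether the part `a` occurs. -/
theorem partCount_insert_add {a : ℕ} {S : Finset ℕ} (ha : 0 < a) (haS : a ∉ S) (n : ℕ) :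
    partCount (insert a S) (n + a) = partCount S (n + a) + partCount (insert a S) n := by
  unfold partCount
  rw [← Finset.card_filter_add_card_filter_not (fun p : Nat.Partition (n + a) => a ∉ p.parts)]
  congr 1
  · congr 1
    ext p
    simp only [Finset.mem_filter, Finset.mem_univ, true_and, Finset.mem_insert]
    constructor
    · rintro ⟨h, hp⟩ i hi
      rcases h i hi with rfl | h'
      · exact absurd hi hp
      · exact h'
    · exact fun h => ⟨fun i hi => Or.inr (h i hi), fun hp => haS (h a hp)⟩
  · symm
    refine Finset.card_bij
      (fun p _ => (⟨a ::ₘ p.parts, ?_, ?_⟩ : Nat.Partition (n + a))) ?_ ?_ ?_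
    · intro i hi
      rcases Multiset.mem_cons.1 hi with rfl | hi
      · exact ha
      · exact p.parts_pos hi
    · rw [Multiset.sum_cons, p.parts_sum, add_comm]
    · intro p hp
      simp only [Finset.mem_filter, Finset.mem_univ, true_and, Finset.mem_insert] at hp ⊢
      refine ⟨fun i hi => ?_, by simp⟩
      rcases Multiset.mem_cons.1 hi with rfl | hi
      · exact Or.inl rfl
      · exact hp i hi
    · intro p _ q _ h
      have := congrArg Nat.Partition.parts h
      exact Nat.Partition.ext (by simpa using this)
    · intro q hq
      simp only [Finset.mem_filter, Finset.mem_univ, true_and, not_not] at hq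
      obtain ⟨t, ht⟩ := Multiset.exists_cons_of_mem hq.2
      have hs := q.parts_sum
      rw [ht, Multiset.sum_cons] at hs
      have hmem : ∀ {i}, i ∈ t → i ∈ q.parts := fun hi => by
        rw [ht]; exact Multiset.mem_cons_of_mem hi
      refine ⟨⟨t, fun hi => q.parts_pos (hmem hi), by omega⟩, ?_, ?_⟩
      · simpa using fun i hi => Finset.mem_insert.1 (hq.1 i (hmem hi))
      · exact Nat.Partition.ext ht.symm

/-- A part larger than `n` does not occur in the partitions of `n`. -/
theorem partCount_insert_of_lt {a n : ℕ} {S : Finset ℕ} (h : n < a) :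
    partCount (insert a S) n = partCount S n := by
  unfold partCount
  congr 1
  ext p
  simp only [Finset.mem_filter, Finset.mem_univ, true_and, Finset.mem_insert]
  refine ⟨fun hp i hi => (hp i hi).resolve_left ?_, fun hp i hi => Or.inr (hp i hi)⟩
  have : i ≤ n := p.parts_sum ▸ Multiset.le_sum_of_mem hi
  omega

theorem partCount_one (n : ℕ) : partCount {1} n = 1 := by
  have h0 : partCount ∅ 0 = 1 := by decide
  have hpos : ∀ n, partCount ∅ (n + 1) = 0 := by
    intro n
    unfold partCount
    rw [Finset.card_eq_zero, Finset.filter_eq_empty_iff]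
    intro p _ hp
    have hz : p.parts = 0 := Multiset.eq_zero_of_forall_notMem fun i hi => by simpa using hp i hi
    simpa [hz] using p.parts_sum
  induction n with
  | zero => exact (partCount_insert_of_lt (S := ∅) Nat.one_pos).trans h0
  | succ n ih =>
    have := partCount_insert_add (S := ∅) Nat.one_pos (by simp) n
    rw [hpos, zero_add] at this
    exact this.trans ih

theorem partCount_one_two (n : ℕ) : partCount {1, 2} n = n / 2 + 1 := by
  rw [Finset.pair_comm]
  induction n using Nat.twoStepInduction with
  | zero => rw [partCount_insert_of_lt (by norm_num), partCount_one]
  | one => rw [partCount_insert_of_lt (by norm_num), partCount_one]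
  | more n ih _ =>
    rw [partCount_insert_add (by norm_num) (by decide), ih, partCount_one]
    omega

theorem partCount_one_two_insert_add {a : ℕ} (ha : 3 ≤ a) (n : ℕ) :
    partCount {1, 2, a} (n + a) = (n + a) / 2 + 1 + partCount {1, 2, a} n := by
  have h : ({1, 2, a} : Finset ℕ) = insert a {1, 2} := by ext; simp; tauto
  rw [h, partCount_insert_add (by omega) (by simp; omega), partCount_one_two]

theorem partCount_one_two_insert_of_lt {a n : ℕ} (h : n < a) :
    partCount {1, 2, a} n = n / 2 + 1 := by
  have h' : ({1, 2, a} : Finset ℕ) = insert a {1, 2} := by ext; simp; tauto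
  rw [h', partCount_insert_of_lt h, partCount_one_two]

theorem partCount_one_two_three_add_six (n : ℕ) :
    partCount {1, 2, 3} (n + 6) = partCount {1, 2, 3} n + n + 6 := by
  have h1 := partCount_one_two_insert_add le_rfl n
  have h2 := partCount_one_two_insert_add le_rfl (n + 3)
  rw [add_assoc n 3 3] at h2
  norm_num at h1 h2
  omega

theorem partCount_one_two_three_six_mul_add (i r : ℕ) :
    partCount {1, 2, 3} (6 * i + r) = partCount {1, 2, 3} r + 3 * i ^ 2 + 3 * i + r * i := by
  induction i with
  | zero => simp
  | succ i ih =>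
    rw [show 6 * (i + 1) + r = 6 * i + r + 6 by ring, partCount_one_two_three_add_six, ih]
    ring

theorem partCount_one_two_three_four_add (n : ℕ) :
    partCount {1, 2, 3, 4} (n + 4) =
      partCount {1, 2, 3} (n + 4) + partCount {1, 2, 3, 4} n := by
  rw [show ({1, 2, 3, 4} : Finset ℕ) = insert 4 {1, 2, 3} by decide]
  exact partCount_insert_add (by norm_num) (by decide) n

theorem partCount_one_two_three_four_eq (i : ℕ) :
    partCount {1, 2, 3, 4} (12 * i + 3) = 3 * (2 * i + 1) ^ 2 * (i + 1) := by
  have h1 : partCount {1, 2, 3} 1 = 1 := partCount_one_two_insert_of_lt (by norm_num)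
  have h3 : partCount {1, 2, 3} 3 = 3 := by
    rw [partCount_one_two_insert_add le_rfl 0, partCount_one_two_insert_of_lt (by norm_num)]
  have h5 : partCount {1, 2, 3} 5 = 5 := by
    rw [partCount_one_two_insert_add le_rfl 2, partCount_one_two_insert_of_lt (by norm_num)]
  induction i with
  | zero =>
    rw [show ({1, 2, 3, 4} : Finset ℕ) = insert 4 {1, 2, 3} by decide,
      partCount_insert_of_lt (by norm_num)]
    exact h3
  | succ i ih =>
    rw [show 12 * (i + 1) + 3 = 12 * i + 3 + 4 + 4 + 4 by ring,
      partCount_one_two_three_four_add, partCount_one_two_three_four_add,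
      partCount_one_two_three_four_add, ih,
      show 12 * i + 3 + 4 + 4 + 4 = 6 * (2 * i + 2) + 3 by ring,
      show 12 * i + 3 + 4 + 4 = 6 * (2 * i + 1) + 5 by ring,
      show 12 * i + 3 + 4 = 6 * (2 * i + 1) + 1 by ring,
      partCount_one_two_three_six_mul_add, partCount_one_two_three_six_mul_add,
      partCount_one_two_three_six_mul_add, h1, h3, h5]
    ring

theorem partCount_one_two_odd {b : ℕ} (hb : 1 ≤ b) (s : ℕ) :
    partCount {1, 2, 2 * b + 1} ((4 * b + 2) * s + 3 * b) = (2 * b + 1) * (s + 1) ^ 2 := by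
  induction s with
  | zero =>
    obtain ⟨c, rfl⟩ := Nat.exists_eq_add_of_le' hb
    rw [show (4 * (c + 1) + 2) * 0 + 3 * (c + 1) = c + (2 * (c + 1) + 1) by ring,
      partCount_one_two_insert_add (by omega), partCount_one_two_insert_of_lt (by omega)]
    omega
  | succ s ih =>
    rw [show (4 * b + 2) * (s + 1) + 3 * b =
        (4 * b + 2) * s + 3 * b + (2 * b + 1) + (2 * b + 1) by ring,
      partCount_one_two_insert_add (by omega), partCount_one_two_insert_add (by omega), ih,
      show (2 * b + 1) * (s + 1 + 1) ^ 2 =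
        4 * (b * s) + 2 * s + 6 * b + 3 + (2 * b + 1) * (s + 1) ^ 2 by ring,
      show (4 * b + 2) * s = 4 * (b * s) + 2 * s by ring]
    omega

theorem partCount_one_two_four_mul {c : ℕ} (hc : 1 ≤ c) (s : ℕ) :
    partCount {1, 2, 4 * c} (4 * c * s + (2 * c - 2)) = c * (s + 1) ^ 2 := by
  induction s with
  | zero =>
    rw [mul_zero, zero_add, partCount_one_two_insert_of_lt (by omega)]
    omega
  | succ s ih =>
    rw [show 4 * c * (s + 1) + (2 * c - 2) = 4 * c * s + (2 * c - 2) + 4 * c by ring,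
      partCount_one_two_insert_add (by omega), ih,
      show c * (s + 1 + 1) ^ 2 = 2 * (c * s) + 3 * c + c * (s + 1) ^ 2 by ring,
      show 4 * c * s = 4 * (c * s) by ring]
    omega

/-- If a partition function takes every value `d * t ^ 2`, it shares infinitely many values with
the partition function for `{1, 2, 3, 4}`. -/
theorem infinite_partCount_eq_of_forall_sq {A : Finset ℕ} {d : ℕ} (hd : 1 ≤ d)
    (h : ∀ s, ∃ m, s ≤ m ∧ partCount A m = d * (s + 1) ^ 2) :
    {mn : ℕ × ℕ | 0 < mn.1 ∧ 0 < mn.2 ∧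
      partCount A mn.1 = partCount {1, 2, 3, 4} mn.2}.Infinite := by
  refine Set.Infinite.of_image Prod.snd (Set.infinite_of_forall_exists_gt fun v => ?_)
  obtain ⟨i, hi⟩ : ∃ i, i + 1 = 12 * d * (v + 1) ^ 2 :=
    ⟨12 * d * (v + 1) ^ 2 - 1, Nat.sub_add_cancel (Nat.succ_le_of_lt (by positivity))⟩
  obtain ⟨m, hm, hm'⟩ := h (6 * (v + 1) * (2 * i + 1) - 1)
  have hpos : 6 ≤ 6 * (v + 1) * (2 * i + 1) := by nlinarith [Nat.zero_le (v * i)]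
  have hv : v ≤ i := by nlinarith [sq_nonneg v]
  refine ⟨12 * i + 3, ⟨(m, 12 * i + 3), ⟨by dsimp only; omega, by simp, ?_⟩, rfl⟩, by omega⟩
  dsimp only
  rw [hm', Nat.sub_add_cancel (by omega), partCount_one_two_three_four_eq, hi]
  ring

theorem stmt13 (a : ℕ) (ha : 3 ≤ a) (hmod : a % 4 ≠ 2) :
    {mn : ℕ × ℕ | 0 < mn.1 ∧ 0 < mn.2 ∧
      partCount {1, 2, a} mn.1 = partCount {1, 2, 3, 4} mn.2}.Infinite := by
  rcases Nat.even_or_odd' a with ⟨b, rfl | rfl⟩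
  · obtain ⟨c, rfl⟩ : ∃ c, b = 2 * c := ⟨b / 2, by omega⟩
    have hc : 1 ≤ c := by omega
    rw [← mul_assoc]
    exact infinite_partCount_eq_of_forall_sq hc fun s =>
      ⟨_, by nlinarith [Nat.zero_le (2 * c - 2)], partCount_one_two_four_mul hc s⟩
  · have hb : 1 ≤ b := by omega
    exact infinite_partCount_eq_of_forall_sq (by omega) fun s =>
      ⟨_, by nlinarith, partCount_one_two_odd hb s⟩
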